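/- arXiv:1707.05512 — 8 statements merged into one kernel-verified Lean document; each statement's English description precedes it below -/
import Mathlib

section
/- Let p ≥ 2 be an integer and let n, l, r, s be integers with 0 ≤ l ≤ r < s ≤ n−1. Let d_0, …, d_{n−1} be integers such that 0 ≤ d_i ≤ 2(p−1) for all i with 0 ≤ i ≤ r or s+1 ≤ i ≤ n−1, such that −(p−1) ≤ d_i ≤ 2(p−1) for all i with r+1 ≤ i ≤ s, and such that d_l ≤ p−2. If p^n − 1 divides Σ_{i=0}^{n−1} d_i·p^i, then Σ_{i=0}^{n−1} d_i·p^i = 0. -/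
/-- The sum of `c * (p - 1) * p ^ i` over `i < n` telescopes. -/
theorem sum_mul_sub_one_mul_pow (p c : ℤ) (n : ℕ) :
    ∑ i ∈ Finset.range n, c * (p - 1) * p ^ i = c * (p ^ n - 1) := by
  rw [← Finset.mul_sum, ← geom_sum_mul p n]
  ring

theorem pow_dvd_sum_range_sub_sum_range (p : ℤ) (d : ℕ → ℤ) {m n : ℕ} (hmn : m ≤ n) :
    p ^ m ∣ ∑ i ∈ Finset.range n, d i * p ^ i - ∑ i ∈ Finset.range m, d i * p ^ i := by
  rw [← Finset.sum_range_add_sum_Ico _ hmn, add_sub_cancel_left]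
  exact Finset.dvd_sum fun i hi => (pow_dvd_pow p (Finset.mem_Ico.mp hi).1).mul_left _


/-- The key divisibility step in the proof of Proposition 3.13: a sum
`Σ d_i p^i` whose digits satisfy the stated bounds and which is divisible by
`p^n - 1` must be zero. -/
theorem digit_sum_eq_zero_of_dvd (p : ℤ) (n l r s : ℕ) (hp : 2 ≤ p) (hn : 1 ≤ n)
    (hlr : l ≤ r) (hrs : r < s) (hsn : s ≤ n - 1) (d : ℕ → ℤ)
    (h1 : ∀ i < n, (i ≤ r ∨ s + 1 ≤ i) → 0 ≤ d i ∧ d i ≤ 2 * (p - 1))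
    (h2 : ∀ i, r + 1 ≤ i → i ≤ s → -(p - 1) ≤ d i ∧ d i ≤ 2 * (p - 1))
    (h3 : d l ≤ p - 2)
    (hdvd : p ^ n - 1 ∣ ∑ i ∈ Finset.range n, d i * p ^ i) :
    ∑ i ∈ Finset.range n, d i * p ^ i = 0 := by
  have hpow (i : ℕ) : 0 < p ^ i := by positivity
  have hln : l < n := by omega
  have hbound (i : ℕ) (hi : i < n) : -1 * (p - 1) ≤ d i ∧ d i ≤ 2 * (p - 1) := by
    by_cases h : i ≤ r ∨ s + 1 ≤ i
    · have := h1 i hi h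
      constructor <;> linarith
    · have := h2 i (by omega) (by omega)
      constructor <;> linarith
  have hl0 := (h1 l hln (Or.inl hlr)).1
  have hupper : ∑ i ∈ Finset.range n, d i * p ^ i < 2 * (p ^ n - 1) := by
    rw [← sum_mul_sub_one_mul_pow]
    refine Finset.sum_lt_sum (fun i hi => ?_) ⟨l, Finset.mem_range.mpr hln, ?_⟩
    · exact mul_le_mul_of_nonneg_right (hbound i (Finset.mem_range.mp hi)).2 (hpow i).le
    · exact mul_lt_mul_of_pos_right (by linarith) (hpow l)
  have hlower : -1 * (p ^ n - 1) < ∑ i ∈ Finset.range n, d i * p ^ i := by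
    rw [← sum_mul_sub_one_mul_pow]
    refine Finset.sum_lt_sum (fun i hi => ?_) ⟨l, Finset.mem_range.mpr hln, ?_⟩
    · exact mul_le_mul_of_nonneg_right (hbound i (Finset.mem_range.mp hi)).1 (hpow i).le
    · exact mul_lt_mul_of_pos_right (by linarith) (hpow l)
  have hpartial0 : 0 ≤ ∑ i ∈ Finset.range (l + 1), d i * p ^ i := by
    refine Finset.sum_nonneg fun i hi => mul_nonneg (h1 i ?_ (Or.inl ?_)).1 (hpow i).le <;>
      have := Finset.mem_range.mp hi <;> omega
  have hpartial : ∑ i ∈ Finset.range (l + 1), d i * p ^ i ≤ p ^ (l + 1) - 2 := by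
    have hlow : ∑ i ∈ Finset.range l, d i * p ^ i ≤ 2 * (p ^ l - 1) := by
      rw [← sum_mul_sub_one_mul_pow]
      refine Finset.sum_le_sum fun i hi => ?_
      have := Finset.mem_range.mp hi
      exact mul_le_mul_of_nonneg_right (hbound i (by omega)).2 (hpow i).le
    have htop := mul_le_mul_of_nonneg_right h3 (hpow l).le
    rw [Finset.sum_range_succ, pow_succ]
    linarith
  have hpn : 0 < p ^ n - 1 := by linarith
  have hresidue := pow_dvd_sum_range_sub_sum_range p d (show l + 1 ≤ n from hln)
  obtain ⟨k, hk⟩ := hdvd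
  rw [hk] at hupper hlower hresidue ⊢
  have hk_lt : k < 2 := by nlinarith
  have hk_gt : -1 < k := by nlinarith
  obtain rfl | rfl : k = 0 ∨ k = 1 := by omega
  · exact mul_zero _
  · have hdvd_succ : p ^ (l + 1) ∣ ∑ i ∈ Finset.range (l + 1), d i * p ^ i + 1 := by
      have h := dvd_sub (pow_dvd_pow p (show l + 1 ≤ n from hln)) hresidue
      rwa [show ∀ a b : ℤ, a - ((a - 1) * 1 - b) = b + 1 by intros; ring] at h
    have := Int.le_of_dvd (by linarith) hdvd_succ
    linarith
end

section
/- Let p ≥ 2 be an integer, n ≥ 1 and 0 ≤ l ≤ n−1. Let d_0, …, d_{n−1} be integers with 0 ≤ d_i ≤ 2(p−1) for all 0 ≤ i < l and −p ≤ d_l ≤ −2 (the integers d_i for i > l are arbitrary). Then N := Σ_{i=0}^{n−1} d_i·p^i is not congruent to −1 modulo p^{l+1}. In particular, if in addition 0 < N < 2(p^n − 1), then p^n − 1 does not divide N. -/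
theorem digit_sum_nonneg (p : ℤ) (l : ℕ) (hp : 0 ≤ p) (d : ℕ → ℤ) (hd : ∀ i < l, 0 ≤ d i) :
    0 ≤ ∑ i ∈ Finset.range l, d i * p ^ i :=
  Finset.sum_nonneg fun i hi => mul_nonneg (hd i (Finset.mem_range.mp hi)) (pow_nonneg hp i)

theorem digit_sum_le (p c : ℤ) (l : ℕ) (hp : 0 ≤ p) (d : ℕ → ℤ)
    (hd : ∀ i < l, d i ≤ c * (p - 1)) :
    ∑ i ∈ Finset.range l, d i * p ^ i ≤ c * (p ^ l - 1) := by
  calc ∑ i ∈ Finset.range l, d i * p ^ i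
      ≤ ∑ i ∈ Finset.range l, c * (p - 1) * p ^ i :=
        Finset.sum_le_sum fun i hi =>
          mul_le_mul_of_nonneg_right (hd i (Finset.mem_range.mp hi)) (pow_nonneg hp i)
    _ = c * (p ^ l - 1) := by
        rw [← Finset.mul_sum, mul_assoc, mul_geom_sum]

theorem digit_sum_modEq_partial_sum (p : ℤ) {m n : ℕ} (hmn : m ≤ n) (d : ℕ → ℤ) :
    ∑ i ∈ Finset.range n, d i * p ^ i ≡ ∑ i ∈ Finset.range m, d i * p ^ i [ZMOD p ^ m] := by
  refine (Int.modEq_iff_dvd.mpr ?_).symm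
  rw [← Finset.sum_range_add_sum_Ico _ hmn, add_sub_cancel_left]
  exact Finset.dvd_sum fun i hi =>
    dvd_mul_of_dvd_right (pow_dvd_pow p (Finset.mem_Ico.mp hi).1) _

/-- The residue obstruction used in the final step of the proof of
Proposition 3.14: if `0 ≤ d_i ≤ 2(p-1)` for `i < l` and `-p ≤ d_l ≤ -2`, then
`N = Σ d_i p^i` is not congruent to `-1` modulo `p^(l+1)`; in particular if
moreover `0 < N < 2(p^n - 1)` then `p^n - 1` does not divide `N`. -/
theorem digit_sum_not_modeq_neg_one (p : ℤ) (n l : ℕ) (hp : 2 ≤ p) (hn : 1 ≤ n)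
    (hl : l ≤ n - 1) (d : ℕ → ℤ)
    (h1 : ∀ i < l, 0 ≤ d i ∧ d i ≤ 2 * (p - 1))
    (h2 : -p ≤ d l ∧ d l ≤ -2) :
    ¬ ((∑ i ∈ Finset.range n, d i * p ^ i) ≡ -1 [ZMOD p ^ (l + 1)]) ∧
    (0 < ∑ i ∈ Finset.range n, d i * p ^ i →
      (∑ i ∈ Finset.range n, d i * p ^ i) < 2 * (p ^ n - 1) →
      ¬ (p ^ n - 1 ∣ ∑ i ∈ Finset.range n, d i * p ^ i)) := by
  have hln : l + 1 ≤ n := by omega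
  have hnot : ¬ ((∑ i ∈ Finset.range n, d i * p ^ i) ≡ -1 [ZMOD p ^ (l + 1)]) := by
    intro h
    have hdvd := ((digit_sum_modEq_partial_sum p hln d).symm.trans h).dvd
    rw [Finset.sum_range_succ] at hdvd
    have hp0 : 0 ≤ p := by omega
    have hlow := digit_sum_nonneg p l hp0 d fun i hi => (h1 i hi).1
    have hupp := digit_sum_le p 2 l hp0 d fun i hi => (h1 i hi).2
    have hpow : 0 ≤ p ^ l := pow_nonneg hp0 l
    have hdlow := mul_le_mul_of_nonneg_right h2.1 hpow
    have hdupp := mul_le_mul_of_nonneg_right h2.2 hpow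
    have hle := Int.le_of_dvd (by linarith) hdvd
    rw [pow_succ] at hle
    linarith
  refine ⟨hnot, ?_⟩
  rintro hpos hlt ⟨c, hc⟩
  have hpn : 0 < p ^ n - 1 := by
    have := one_lt_pow₀ (show 1 < p by omega) (show n ≠ 0 by omega)
    omega
  rw [hc] at hpos hlt
  have hc0 : 0 < c := pos_of_mul_pos_right hpos hpn.le
  have hc2 : c < 2 := by nlinarith
  obtain rfl : c = 1 := by omega
  apply hnot
  rw [hc, mul_one]
  refine (Int.modEq_iff_dvd.mpr ?_).symm
  rw [sub_neg_eq_add, sub_add_cancel]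
  exact pow_dvd_pow p hln
end

section
/- Fix a prime p and an integer n ≥ 2, and let m be an integer with 1 ≤ m ≤ p^{n−1} and p-adic valuation r = r_m. Let b and c be integers with 0 ≤ b, c ≤ p^n − 2, such that c is in layer i for some i ≤ r and b is in layer s for some s with r < s ≤ n−1. Assume m_{s−1} + b_s < p − 1, where m_{s−1} is the (s−1)-th base-p digit of m and b_s the s-th base-p digit of b. Then there is no n-tuple (k_0, …, k_{n−1}) of integers satisfying all of: (1) max{0, c_j − b_j} ≤ k_j ≤ c_j for every 0 ≤ j ≤ n−1; (2) there exists an index l with k_l < p − 1 − b_l; (3) p^n − 1 divides ⌊m⌋_s·p − m·p + Σ_{j=0}^{n−1} p^j·(b_j − c_j + 2k_j). -/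
/-- The `i`-th base-`p` digit of `a`. -/
def digit (p a i : ℕ) : ℕ := a / p ^ i % p

/-- `a` is in layer `s` (for `0 ≤ s ≤ n-1`): `p^n - p^(s+1) ≤ a ≤ p^n - p^s - 1`. -/
def InLayer (p n a s : ℕ) : Prop :=
  s < n ∧ p ^ n - p ^ (s + 1) ≤ a ∧ a ≤ p ^ n - p ^ s - 1

/-- The floor of `m` at `s`: `⌊m⌋_s = p^s * (m / p^s)`. -/
def floorAt (p m s : ℕ) : ℕ := p ^ s * (m / p ^ s)

theorem digit_eq_pred_of_inLayer {p n c i j : ℕ} (hp : p.Prime) (hc : InLayer p n c i)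
    (hij : i < j) (hjn : j < n) : digit p c j = p - 1 := by
  obtain ⟨-, h1, h2⟩ := hc
  have hpos : 0 < p ^ j := pow_pos hp.pos j
  have hij' : p ^ (i + 1) ≤ p ^ j := Nat.pow_le_pow_right hp.pos hij
  have hi : 0 < p ^ i := pow_pos hp.pos i
  have hn : 0 < p ^ n := pow_pos hp.pos n
  obtain ⟨d, rfl⟩ := Nat.exists_eq_add_of_lt hjn
  have hd : 0 < p ^ d := pow_pos hp.pos d
  have hfac : p ^ (j + d + 1) = (p * p ^ d - 1) * p ^ j + p ^ j := by
    rw [← Nat.succ_mul, Nat.succ_eq_add_one, Nat.sub_add_cancel (Nat.mul_pos hp.pos hd)]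
    ring
  have hdiv : c / p ^ j = p * p ^ d - 1 := by
    apply Nat.div_eq_of_lt_le
    · omega
    · rw [Nat.succ_mul]
      omega
  have hsplit : p * p ^ d - 1 = (p - 1) + p * (p ^ d - 1) := by
    have := hp.pos
    rw [Nat.mul_sub, mul_one]
    have : p ≤ p * p ^ d := Nat.le_mul_of_pos_right p hd
    omega
  rw [digit, hdiv, hsplit, Nat.add_mul_mod_self_left, Nat.mod_eq_of_lt]
  have := hp.pos
  omega

theorem sum_range_pow_mul_pred (p : ℤ) (n : ℕ) :
    ∑ j ∈ Finset.range n, p ^ j * (p - 1) = p ^ n - 1 := by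
  rw [← Finset.sum_mul, geom_sum_mul]

theorem eq_pred_of_pow_dvd_one_add_sum {p : ℤ} (hp : 0 < p) {x : ℕ → ℤ} (t : ℕ)
    (hx : ∀ j < t, 0 ≤ x j ∧ x j ≤ 2 * (p - 1))
    (h : p ^ t ∣ 1 + ∑ j ∈ Finset.range t, p ^ j * x j) : ∀ j < t, x j = p - 1 := by
  induction t with
  | zero => simp
  | succ t ih =>
    rw [Finset.sum_range_succ, ← add_assoc] at h
    have hlow : ∀ j < t, x j = p - 1 := by
      refine ih (fun j hj => hx j (by omega)) ?_
      exact (dvd_add_left (dvd_mul_right _ _)).mp ((pow_dvd_pow p t.le_succ).trans h)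
    have hsum : ∑ j ∈ Finset.range t, p ^ j * x j = p ^ t - 1 := by
      rw [← sum_range_pow_mul_pred]
      exact Finset.sum_congr rfl fun j hj => by rw [hlow j (Finset.mem_range.mp hj)]
    have hfac : 1 + (p ^ t - 1) + p ^ t * x t = p ^ t * (1 + x t) := by ring
    rw [hsum, hfac, pow_succ] at h
    obtain ⟨u, hu⟩ := (mul_dvd_mul_iff_left (pow_ne_zero t hp.ne')).mp h
    have ⟨h0, h1⟩ := hx t t.lt_succ_self
    have hu0 : 0 < u := by nlinarith
    have hu2 : u < 2 := by nlinarith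
    obtain rfl : u = 1 := by omega
    intro j hj
    rcases Nat.lt_succ_iff_lt_or_eq.mp hj with hj | rfl
    · exact hlow j hj
    · linarith

/-- Arithmetic content of Proposition 3.13(a): when `m_{s-1} + b_s < p - 1` there is no
tuple `(k_0, …, k_{n-1})` satisfying Holloway's conditions, i.e. the corresponding stable
homomorphism space vanishes. -/
theorem no_holloway_tuple (p n m r s i b c : ℕ) (hp : p.Prime) (hn : 2 ≤ n)
    (hm1 : 1 ≤ m) (hm2 : m ≤ p ^ (n - 1))
    (hr : p ^ r ∣ m ∧ ¬ p ^ (r + 1) ∣ m)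
    (hb : b ≤ p ^ n - 2) (hc : c ≤ p ^ n - 2)
    (hir : i ≤ r) (hci : InLayer p n c i)
    (hrs : r < s) (hsn : s ≤ n - 1) (hbs : InLayer p n b s)
    (hcond : digit p m (s - 1) + digit p b s < p - 1) :
    ¬ ∃ k : ℕ → ℤ,
      (∀ j < n, max 0 ((digit p c j : ℤ) - (digit p b j : ℤ)) ≤ k j ∧
        k j ≤ (digit p c j : ℤ)) ∧
      (∃ l < n, k l < (p : ℤ) - 1 - (digit p b l : ℤ)) ∧
      ((p : ℤ) ^ n - 1 ∣
        (floorAt p m s : ℤ) * (p : ℤ) - (m : ℤ) * (p : ℤ) +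
          ∑ j ∈ Finset.range n,
            (p : ℤ) ^ j * ((digit p b j : ℤ) - (digit p c j : ℤ) + 2 * k j)) := by
  rintro ⟨k, hk, ⟨l, hln, hl⟩, hdvd⟩
  have hp2 : (2 : ℤ) ≤ p := by exact_mod_cast hp.two_le
  have hp0 : (0 : ℤ) < p := by linarith
  have hdig (a j : ℕ) : 0 ≤ (digit p a j : ℤ) ∧ (digit p a j : ℤ) ≤ p - 1 := by
    have : digit p a j < p := Nat.mod_lt _ hp.pos
    omega
  have htop (j : ℕ) (h1 : i < j) (h2 : j < n) : (digit p c j : ℤ) = p - 1 := by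
    rw [digit_eq_pred_of_inLayer hp hci h1 h2, Nat.cast_sub hp.one_le, Nat.cast_one]
  set x : ℕ → ℤ := fun j => (digit p b j : ℤ) - (digit p c j : ℤ) + 2 * k j with hx
  have hxj (j : ℕ) (hj : j < n) : 0 ≤ x j ∧ x j ≤ 2 * (p - 1) := by
    have := hk j hj
    have := hdig b j
    have := hdig c j
    simp only [hx]
    omega
  have hli : l ≤ i := by
    by_contra hil
    have := htop l (by omega) hln
    have := hk l hln
    omega
  have hxl : x l < p - 1 := by
    have := hk l hln
    simp only [hx]
    omega
  have hsn' : s < n := hbs.1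
  have hS_lower : (p : ℤ) ^ s * (p - 1 - digit p b s) ≤
      ∑ j ∈ Finset.range n, (p : ℤ) ^ j * x j := by
    refine le_trans ?_ (Finset.single_le_sum (f := fun j => (p : ℤ) ^ j * x j)
      (fun j hj => mul_nonneg (by positivity) (hxj j (Finset.mem_range.mp hj)).1)
      (Finset.mem_range.mpr hsn'))
    refine mul_le_mul_of_nonneg_left ?_ (by positivity)
    have := htop s (by omega) hsn'
    have := hk s hsn'
    simp only [hx]
    omega
  have hS_upper : ∑ j ∈ Finset.range n, (p : ℤ) ^ j * x j ≤ 2 * ((p : ℤ) ^ n - 1) := by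
    rw [← sum_range_pow_mul_pred, Finset.mul_sum]
    refine Finset.sum_le_sum fun j hj => ?_
    have := mul_le_mul_of_nonneg_left (hxj j (Finset.mem_range.mp hj)).2
      (pow_nonneg hp0.le j)
    linarith
  have hfloor : (floorAt p m s : ℤ) + (m % p ^ s : ℕ) = m := by
    exact_mod_cast Nat.div_add_mod m (p ^ s)
  have hmod_pos : (0 : ℤ) < (m % p ^ s : ℕ) := by
    rw [Nat.cast_pos, Nat.pos_iff_ne_zero]
    exact fun h => hr.2 ((pow_dvd_pow p hrs).trans (Nat.dvd_of_mod_eq_zero h))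
  have hmod_lt : (p : ℤ) * (m % p ^ s : ℕ) < (p : ℤ) ^ s * (digit p m (s - 1) + 1) := by
    obtain ⟨t, rfl⟩ : ∃ t, s = t + 1 := ⟨s - 1, by omega⟩
    have h1 : m % p ^ t < p ^ t := Nat.mod_lt _ (pow_pos hp.pos t)
    have h2 : m % p ^ (t + 1) < p ^ t * (digit p m t + 1) := by
      rw [Nat.mod_pow_succ, digit]
      linarith
    have h3 := Nat.mul_lt_mul_of_pos_left h2 hp.pos
    rw [← mul_assoc, ← pow_succ'] at h3
    exact_mod_cast h3
  have hlt : (p : ℤ) * (m % p ^ s : ℕ) < ∑ j ∈ Finset.range n, (p : ℤ) ^ j * x j := by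
    refine hmod_lt.trans_le (le_trans ?_ hS_lower)
    refine mul_le_mul_of_nonneg_left ?_ (by positivity)
    omega
  have hq : (1 : ℤ) < (p : ℤ) ^ n := one_lt_pow₀ (by linarith) (by omega)
  have hS : ∑ j ∈ Finset.range n, (p : ℤ) ^ j * x j
      = (p : ℤ) ^ n - 1 + p * (m - floorAt p m s) := by
    obtain ⟨u, hu⟩ := hdvd
    have hmod : 0 < (p : ℤ) * (m % p ^ s : ℕ) := mul_pos hp0 hmod_pos
    have hrel : ∑ j ∈ Finset.range n, (p : ℤ) ^ j * x j - p * (m % p ^ s : ℕ)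
        = ((p : ℤ) ^ n - 1) * u := by
      rw [← hu, ← hfloor]
      ring
    have hu0 : 0 < u := pos_of_mul_pos_right (by linarith : 0 < ((p : ℤ) ^ n - 1) * u)
      (by linarith)
    have hu2 : u < 2 :=
      lt_of_mul_lt_mul_left (by linarith : ((p : ℤ) ^ n - 1) * u < ((p : ℤ) ^ n - 1) * 2)
        (by linarith)
    obtain rfl : u = 1 := by omega
    rw [← hfloor]
    linarith
  have hpow : (p : ℤ) ^ (r + 1) ∣ 1 + ∑ j ∈ Finset.range n, (p : ℤ) ^ j * x j := by
    have h1 : (p : ℤ) ^ r ∣ m := by exact_mod_cast hr.1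
    have h2 : (p : ℤ) ^ r ∣ floorAt p m s := by
      exact_mod_cast (pow_dvd_pow p hrs.le).trans (dvd_mul_right _ _)
    have h3 : (p : ℤ) ^ (r + 1) ∣ (p : ℤ) ^ n := pow_dvd_pow _ (by omega)
    have h4 : (p : ℤ) ^ (r + 1) ∣ p * (m - floorAt p m s) := by
      rw [pow_succ']
      exact mul_dvd_mul_left _ (dvd_sub h1 h2)
    have h5 : 1 + ((p : ℤ) ^ n - 1 + p * (m - floorAt p m s))
        = (p : ℤ) ^ n + p * (m - floorAt p m s) := by ring
    rw [hS, h5]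
    exact dvd_add h3 h4
  have htail : (p : ℤ) ^ (r + 1) ∣ ∑ j ∈ Finset.Ico (r + 1) n, (p : ℤ) ^ j * x j :=
    Finset.dvd_sum fun j hj =>
      (pow_dvd_pow _ (Finset.mem_Ico.mp hj).1).trans (dvd_mul_right _ _)
  rw [← Finset.sum_range_add_sum_Ico _ (by omega : r + 1 ≤ n), ← add_assoc,
    dvd_add_left htail] at hpow
  have := eq_pred_of_pow_dvd_one_add_sum hp0 (r + 1) (fun j hj => hxj j (by omega)) hpow l
    (by omega)
  omega
end

section
/- Fix a prime p and an integer n ≥ 2, and let m be an integer with 1 ≤ m ≤ p^{n−1} and p-adic valuation r = r_m. Let b and c be integers with 0 ≤ b, c ≤ p^n − 2, such that c is in layer i for some i ≤ r and b is in layer s for some s with r < s ≤ n−1, and assume m_{s−1} + b_s ≥ p − 1, where m_{s−1} is the (s−1)-th base-p digit of m and b_s the s-th base-p digit of b. Let b′ be the partner of b, so b′_j = b_j for j ≠ s and b′_s = p−2−b_s. Then there is no pair consisting of an index l (0 ≤ l ≤ n−1) and an n-tuple (k_0, …, k_{n−1}) of integers satisfying all of: (1) b′_l ≤ p−2 and c_l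 ≤ p−2; (2) max{0, c_j − b′_j} ≤ k_j ≤ c_j for every j ≠ l; (3) max{0, b′_l + c_l + 2 − p} ≤ k_l ≤ min{b′_l, c_l}; (4) p^n − 1 divides ⌈m⌉^s·p − m·p + Σ_{j≠l} p^j·(b′_j − c_j + 2k_j) + p^l·(−b′_l − c_l + 2k_l − 2). -/
/-- The ceiling of `m` at `s`: `⌈m⌉^s = p^s * (m / p^s) + p^s`. -/
def ceilAt (p m s : ℕ) : ℕ := p ^ s * (m / p ^ s) + p ^ s

/-- The partner of `b` (in layer `s`): `b` with its `s`-th base-`p` digit `b_s`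
replaced by `p - 2 - b_s`. -/
def partnerAt (p b s : ℕ) : ℕ := b - digit p b s * p ^ s + (p - 2 - digit p b s) * p ^ s

open Finset in
/-- If the coefficients `d j`, `j ≠ l`, lie in `[0, 2p-2]` and the coefficient at `l` is `-e` with
`2 ≤ e ≤ p`, then the weighted sum of coefficients, shifted by a multiple `M` of `p ^ (l + 1)` which
fits on top of `d s`, is never divisible by `p ^ n - 1`. -/
theorem not_dvd_add_sum_erase {p : ℤ} (hp : 2 ≤ p) {n l s : ℕ} (hls : l < s) (hsn : s < n)
    {d : ℕ → ℤ} (hd : ∀ j < n, j ≠ l → 0 ≤ d j ∧ d j ≤ 2 * p - 2) {e M : ℤ} (he : 2 ≤ e)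
    (hep : e ≤ p) (hM : 0 < M) (hMl : p ^ (l + 1) ∣ M) (hds : 1 ≤ d s)
    (hMs : M + p ^ s * d s ≤ p ^ s * (2 * p - 2)) :
    ¬ p ^ n - 1 ∣ M + ∑ j ∈ (range n).erase l, p ^ j * d j - p ^ l * e := by
  intro hdvd
  have hpos (j : ℕ) : 0 < p ^ j := by positivity
  have hln : l < n := hls.trans hsn
  have hsmem : s ∈ (range n).erase l := by simp [hsn, hls.ne']
  have geom (t : ℕ) : ∑ j ∈ range t, p ^ j * (2 * p - 2) = 2 * (p ^ t - 1) := by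
    rw [← mul_geom_sum, ← sum_mul]; ring
  have upper : M + ∑ j ∈ (range n).erase l, p ^ j * d j ≤ 2 * (p ^ n - 1) - p ^ l * (2 * p - 2) := by
    rw [← geom n, ← add_sum_erase _ _ (mem_range.2 hln), ← add_sum_erase _ _ hsmem,
      ← add_sum_erase _ _ hsmem]
    have : ∑ j ∈ ((range n).erase l).erase s, p ^ j * d j ≤
        ∑ j ∈ ((range n).erase l).erase s, p ^ j * (2 * p - 2) := by
      refine sum_le_sum fun j hj ↦ mul_le_mul_of_nonneg_left ?_ (hpos j).le
      simp only [mem_erase, mem_range] at hj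
      exact (hd j hj.2.2 hj.2.1).2
    linarith
  have lower : p ^ s ≤ ∑ j ∈ (range n).erase l, p ^ j * d j := by
    refine le_trans (le_mul_of_one_le_right (hpos s).le hds)
      (single_le_sum (f := fun j ↦ p ^ j * d j) (fun j hj ↦ ?_) hsmem)
    simp only [mem_erase, mem_range] at hj
    exact mul_nonneg (hpos j).le (hd j hj.2 hj.1).1
  have hpe : p ^ l * e ≤ p ^ s := calc
    p ^ l * e ≤ p ^ l * p := mul_le_mul_of_nonneg_left hep (hpos l).le
    _ = p ^ (l + 1) := (pow_succ _ _).symm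
    _ ≤ p ^ s := pow_le_pow_right₀ (by linarith) hls
  have total : M + ∑ j ∈ (range n).erase l, p ^ j * d j - p ^ l * e = p ^ n - 1 := by
    obtain ⟨q, hq⟩ := hdvd
    have hpn : 0 < p ^ n - 1 := by
      have := one_lt_pow₀ (show 1 < p by linarith) (show n ≠ 0 by lia)
      linarith
    have h0 : 0 < (p ^ n - 1) * q := by linarith
    have h2 : (p ^ n - 1) * q < (p ^ n - 1) * 2 := by nlinarith [hpos l]
    have hq1 : q = 1 := by
      have := pos_of_mul_pos_right h0 hpn.le
      have := lt_of_mul_lt_mul_left h2 hpn.le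
      lia
    rw [hq, hq1, mul_one]
  have split : ∑ j ∈ (range n).erase l, p ^ j * d j =
      ∑ j ∈ range l, p ^ j * d j + ∑ j ∈ Ico (l + 1) n, p ^ j * d j := by
    rw [← sum_union]
    · refine sum_congr ?_ fun _ _ ↦ rfl
      ext j
      simp only [mem_erase, mem_range, mem_union, mem_Ico]
      lia
    · rw [disjoint_left]
      intro j
      simp only [mem_range, mem_Ico]
      lia
  obtain ⟨H, hH⟩ : p ^ (l + 1) ∣ p ^ n - M - ∑ j ∈ Ico (l + 1) n, p ^ j * d j := by
    refine ((pow_dvd_pow p hln).sub hMl).sub (dvd_sum fun j hj ↦ ?_)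
    exact (pow_dvd_pow p (mem_Ico.1 hj).1).mul_right _
  have low0 : 0 ≤ ∑ j ∈ range l, p ^ j * d j := sum_nonneg fun j hj ↦
    mul_nonneg (hpos j).le (hd j ((mem_range.1 hj).trans hln) (mem_range.1 hj).ne).1
  have low1 : ∑ j ∈ range l, p ^ j * d j ≤ 2 * (p ^ l - 1) := by
    rw [← geom l]
    exact sum_le_sum fun j hj ↦ mul_le_mul_of_nonneg_left
      (hd j ((mem_range.1 hj).trans hln) (mem_range.1 hj).ne).2 (hpos j).le
  have key : ∑ j ∈ range l, p ^ j * d j + 1 = p ^ l * (p * H + e) := by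
    rw [pow_succ] at hH
    linarith
  have h1 : p * H + e = 1 := by
    have h0 : 0 < p ^ l * (p * H + e) := by linarith
    have h2 : p ^ l * (p * H + e) < p ^ l * 2 := by linarith
    have := pos_of_mul_pos_right h0 (hpos l).le
    have := lt_of_mul_lt_mul_left h2 (hpos l).le
    lia
  have hH0 : H < 0 := by
    by_contra! h
    nlinarith
  nlinarith

theorem digit_eq_of_inLayer {p n a i j : ℕ} (hp : 2 ≤ p) (h : InLayer p n a i) (hij : i < j)
    (hjn : j < n) : digit p a j = p - 1 := by
  obtain ⟨-, h1, h2⟩ := h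
  have hi : 0 < p ^ i := by positivity
  have hij' : p ^ (i + 1) ≤ p ^ j := Nat.pow_le_pow_right (by lia) hij
  obtain ⟨u, rfl⟩ := Nat.exists_eq_add_of_lt hjn
  have hu : 0 < p ^ u := by positivity
  have hpn : p ^ (j + u + 1) = p ^ j * (p * p ^ u) := by ring
  rw [hpn] at h1 h2
  have hlow : p ^ j * (p * p ^ u - 1) ≤ a := by
    rw [Nat.mul_sub, mul_one]
    lia
  have hup : a < p ^ j * (p * p ^ u - 1 + 1) := by
    rw [Nat.sub_add_cancel (by nlinarith)]
    have : 0 < p ^ j * (p * p ^ u) := by positivity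
    lia
  obtain ⟨v, hv⟩ := Nat.exists_eq_add_of_lt hu
  have hdiv : a / p ^ j = p - 1 + p * v := by
    rw [Nat.div_eq_of_lt_le (by rwa [mul_comm]) (by rwa [mul_comm]), hv, mul_add]
    lia
  rw [digit, hdiv, Nat.add_mul_mod_self_left, Nat.mod_eq_of_lt (by lia)]

theorem digit_le_of_inLayer {p n a s : ℕ} (hp : 2 ≤ p) (h : InLayer p n a s) :
    digit p a s ≤ p - 2 := by
  obtain ⟨hsn, h1, h2⟩ := h
  have hs : 0 < p ^ s := by positivity
  obtain ⟨u, rfl⟩ := Nat.exists_eq_add_of_lt hsn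
  obtain ⟨v, hv⟩ := Nat.exists_eq_add_of_lt (show 0 < p ^ u by positivity)
  have hpn : p ^ (s + u + 1) = p ^ s * (p * v) + p ^ s * p := by
    rw [pow_succ, pow_add, hv]; ring
  rw [hpn, pow_succ] at h1
  rw [hpn] at h2
  have hle : p ^ s * 2 ≤ p ^ s * p := Nat.mul_le_mul_left _ hp
  have hlow : p * v ≤ a / p ^ s := by
    rw [Nat.le_div_iff_mul_le hs, mul_comm]
    lia
  have hup : a / p ^ s < p * v + (p - 1) := by
    rw [Nat.div_lt_iff_lt_mul hs, mul_comm, mul_add, Nat.mul_sub, mul_one]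
    lia
  obtain ⟨x, hx⟩ := Nat.exists_eq_add_of_le hlow
  rw [digit, hx, Nat.mul_add_mod, Nat.mod_eq_of_lt (by lia)]
  lia

theorem digit_partnerAt_self {p b s : ℕ} (hp : 2 ≤ p) :
    digit p (partnerAt p b s) s = p - 2 - digit p b s := by
  have hs : 0 < p ^ s := by positivity
  have hb : b = (p * (b / p ^ s / p) + digit p b s) * p ^ s + b % p ^ s := by
    rw [digit, Nat.div_add_mod, Nat.div_add_mod']
  have hb' : partnerAt p b s =
      b % p ^ s + (p - 2 - digit p b s + p * (b / p ^ s / p)) * p ^ s := by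
    have : b - digit p b s * p ^ s = p * (b / p ^ s / p) * p ^ s + b % p ^ s := by
      rw [add_mul] at hb
      lia
    rw [partnerAt, this]
    ring
  have hlt : p - 2 - digit p b s < p := by lia
  rw [hb']
  generalize p - 2 - digit p b s = x at *
  rw [digit, Nat.add_mul_div_right _ _ hs, Nat.div_eq_of_lt (Nat.mod_lt _ hs), zero_add,
    Nat.add_mul_mod_self_left, Nat.mod_eq_of_lt hlt]

theorem digit_mul_pow_le_mod (p m t : ℕ) : digit p m t * p ^ t ≤ m % p ^ (t + 1) := by
  rw [Nat.mod_pow_succ, digit, mul_comm]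
  exact Nat.le_add_left _ _

theorem ceilAt_sub (p m s : ℕ) : (ceilAt p m s : ℤ) - m = p ^ s - (m % p ^ s : ℕ) := by
  have : (p ^ s * (m / p ^ s) + m % p ^ s : ℕ) = m := Nat.div_add_mod _ _
  have h : ((p ^ s * (m / p ^ s) + m % p ^ s : ℕ) : ℤ) = m := by rw [this]
  rw [ceilAt]
  push_cast at h ⊢
  linarith

/-- Arithmetic content of Proposition 3.14: when `m_{s-1} + b_s ≥ p - 1` there is no pair
`(l, k)` satisfying Carlson's conditions for the partner `b'` of `b`, i.e. the
corresponding extension group vanishes. -/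
theorem no_carlson_pair (p n m r s i b c : ℕ) (hp : p.Prime) (hn : 2 ≤ n)
    (hm1 : 1 ≤ m) (hm2 : m ≤ p ^ (n - 1))
    (hr : p ^ r ∣ m ∧ ¬ p ^ (r + 1) ∣ m)
    (hb : b ≤ p ^ n - 2) (hc : c ≤ p ^ n - 2)
    (hir : i ≤ r) (hci : InLayer p n c i)
    (hrs : r < s) (hsn : s ≤ n - 1) (hbs : InLayer p n b s)
    (hcond : p - 1 ≤ digit p m (s - 1) + digit p b s) :
    ¬ ∃ l < n, ∃ k : ℕ → ℤ,
      (digit p (partnerAt p b s) l ≤ p - 2 ∧ digit p c l ≤ p - 2) ∧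
      (∀ j < n, j ≠ l →
        max 0 ((digit p c j : ℤ) - (digit p (partnerAt p b s) j : ℤ)) ≤ k j ∧
          k j ≤ (digit p c j : ℤ)) ∧
      (max 0 ((digit p (partnerAt p b s) l : ℤ) + (digit p c l : ℤ) + 2 - (p : ℤ)) ≤ k l ∧
        k l ≤ min (digit p (partnerAt p b s) l : ℤ) (digit p c l : ℤ)) ∧
      ((p : ℤ) ^ n - 1 ∣
        (ceilAt p m s : ℤ) * (p : ℤ) - (m : ℤ) * (p : ℤ) +
          (∑ j ∈ (Finset.range n).erase l,
            (p : ℤ) ^ j *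
              ((digit p (partnerAt p b s) j : ℤ) - (digit p c j : ℤ) + 2 * k j)) +
          (p : ℤ) ^ l *
            (-(digit p (partnerAt p b s) l : ℤ) - (digit p c l : ℤ) + 2 * k l - 2)) := by
  rintro ⟨l, hl, k, ⟨-, hcl⟩, hk, ⟨hkl, hkl'⟩, hdvd⟩
  have hp2 := hp.two_le
  have hsn' : s < n := by lia
  have hli : l ≤ i := by
    by_contra! h
    have := digit_eq_of_inLayer hp2 hci h hl
    lia
  have hcs : digit p c s = p - 1 := digit_eq_of_inLayer hp2 hci (show i < s by lia) hsn'
  have hbs' : digit p (partnerAt p b s) s = p - 2 - digit p b s := digit_partnerAt_self hp2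
  have hbs2 : digit p b s ≤ p - 2 := digit_le_of_inLayer hp2 hbs
  have hlt (a j : ℕ) : digit p a j < p := Nat.mod_lt _ hp.pos
  have hks := hk s hsn' (show s ≠ l by lia)
  have hM : (ceilAt p m s : ℤ) * p - m * p = ((p : ℤ) ^ s - (m % p ^ s : ℕ)) * p := by
    rw [← sub_mul, ceilAt_sub]
  have hmod : ((m % p ^ s : ℕ) : ℤ) < (p : ℤ) ^ s := by
    exact_mod_cast Nat.mod_lt m (pow_pos hp.pos s)
  have hMs : ((p : ℤ) ^ s - (m % p ^ s : ℕ)) * p ≤ p ^ s * (digit p b s + 1) := by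
    obtain ⟨t, rfl⟩ := Nat.exists_eq_succ_of_ne_zero (show s ≠ 0 by lia)
    have h1 : (digit p m t * p ^ t : ℤ) ≤ (m % p ^ (t + 1) : ℕ) := by
      exact_mod_cast digit_mul_pow_le_mod p m t
    have h2 : (p : ℤ) - digit p m t ≤ digit p b (t + 1) + 1 := by
      rw [Nat.succ_sub_one] at hcond
      lia
    calc ((p : ℤ) ^ (t + 1) - (m % p ^ (t + 1) : ℕ)) * p
        ≤ ((p : ℤ) ^ (t + 1) - digit p m t * p ^ t) * p := by gcongr
      _ = p ^ (t + 1) * (p - digit p m t) := by ring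
      _ ≤ p ^ (t + 1) * (digit p b (t + 1) + 1) := by gcongr
  refine not_dvd_add_sum_erase (p := p) (by exact_mod_cast hp2) (show l < s by lia) hsn'
    (d := fun j ↦ (digit p (partnerAt p b s) j : ℤ) - digit p c j + 2 * k j)
    (e := digit p (partnerAt p b s) l + digit p c l - 2 * k l + 2)
    (M := (ceilAt p m s : ℤ) * p - m * p) ?_ ?_ ?_ ?_ ?_ ?_ ?_ ?_
  · intro j hj hjl
    have := hk j hj hjl
    have := hlt c j
    have := hlt (partnerAt p b s) j
    lia
  · lia
  · lia
  · rw [hM]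
    exact mul_pos (by linarith) (by exact_mod_cast hp.pos)
  · rw [← sub_mul, pow_succ]
    refine mul_dvd_mul_right ((pow_dvd_pow _ (hli.trans hir)).trans (dvd_sub ?_ ?_)) _
    · rw [ceilAt]
      push_cast
      rw [← mul_add_one]
      exact (pow_dvd_pow _ hrs.le).mul_right _
    · exact_mod_cast hr.1
  · lia
  · have hds : (digit p (partnerAt p b s) s : ℤ) - digit p c s + 2 * k s ≤
        2 * p - 2 - (digit p b s + 1) := by lia
    have := mul_le_mul_of_nonneg_left hds (show (0 : ℤ) ≤ (p : ℤ) ^ s by positivity)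
    rw [hM]
    linarith
  · convert hdvd using 1
    ring
end

section
/- Let p ≥ 2 and n ≥ 2 be integers and let j be an integer with 0 ≤ j ≤ n−2. If a is an integer with p^n − p^{j+1} ≤ a ≤ p^n − p^j − 1 (i.e. a is in layer j), then p^n − p^{j+2} ≤ (p·a) mod (p^n − 1) ≤ p^n − p^{j+1} − 1; that is, (p·a) mod (p^n − 1) is in layer j+1. -/
/-- The unnumbered lemma in Section 4.2 of the paper: if `a` is in layer `j` (with
`j ≤ n - 2`), then `p * a` modulo `p^n - 1` is in layer `j + 1`. -/
theorem layer_succ_of_mul_p (p n j a : ℕ) (hp : 2 ≤ p) (hn : 2 ≤ n) (hj : j ≤ n - 2)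
    (ha1 : p ^ n - p ^ (j + 1) ≤ a) (ha2 : a ≤ p ^ n - p ^ j - 1) :
    p ^ n - p ^ (j + 2) ≤ (p * a) % (p ^ n - 1) ∧
      (p * a) % (p ^ n - 1) ≤ p ^ n - p ^ (j + 1) - 1 := by
  have hq : 0 < p ^ j := by positivity
  have hle : p ^ (j + 2) ≤ p ^ n := Nat.pow_le_pow_right (by omega) (by omega)
  have hpow1 : p ^ (j + 1) = p * p ^ j := pow_succ' p j
  have hpow2 : p ^ (j + 2) = p * p ^ (j + 1) := pow_succ' p (j + 1)
  have hq1 : 2 * p ^ j ≤ p ^ (j + 1) := hpow1 ▸ Nat.mul_le_mul_right _ hp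
  have hq2 : 2 * p ^ (j + 1) ≤ p ^ (j + 2) := hpow2 ▸ Nat.mul_le_mul_right _ hp
  obtain ⟨c, hc⟩ : ∃ c, p ^ n - 1 = a + c := ⟨p ^ n - 1 - a, by omega⟩
  have hc1 : p ^ (j + 1) ≤ p * c := hpow1 ▸ Nat.mul_le_mul_left p (by omega)
  have hc2 : p * (c + 1) ≤ p ^ (j + 2) := hpow2 ▸ Nat.mul_le_mul_left p (by omega)
  rw [mul_add_one] at hc2
  obtain ⟨r, hr⟩ : ∃ r, p ^ n - 1 = r + p * c := ⟨p ^ n - 1 - p * c, by omega⟩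
  have hmod : (p * a) % (p ^ n - 1) = r := by
    obtain ⟨k, rfl⟩ : ∃ k, p = k + 1 := ⟨p - 1, by omega⟩
    have hmul : (k + 1) * a = r + ((k + 1) ^ n - 1) * k := by
      generalize (k + 1) ^ n - 1 = m at hc hr ⊢
      subst hc
      linarith
    rw [hmul, Nat.add_mul_mod_self_left, Nat.mod_eq_of_lt (by omega)]
  rw [hmod]
  omega
end

section
/- Let p ≥ 2 and n ≥ 1 be integers and let a be an integer with 0 ≤ a ≤ p^n − 2. For each i with 0 ≤ i ≤ n−1 let Z_i denote the layer of (p^i·a) mod (p^n − 1), and for each j with 0 ≤ j ≤ n−1 let λ_j be the number of indices i ∈ {0, …, n−1} with Z_i = n−1−j. Then λ_0 ≥ λ_1 ≥ ⋯ ≥ λ_{n−1} and λ_0 + λ_1 + ⋯ + λ_{n−1} = n; that is, (λ_0, …, λ_{n−1}) is a partition of n. -/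
theorem InLayer.unique {p n a s t : ℕ} (hp : 2 ≤ p) (hs : InLayer p n a s)
    (ht : InLayer p n a t) : s = t := by
  have key : ∀ s t, InLayer p n a s → InLayer p n a t → ¬ s < t := by
    rintro s t ⟨-, hs, -⟩ ⟨htn, -, ht⟩ hst
    have h₁ : p ^ (s + 1) ≤ p ^ t := Nat.pow_le_pow_right (by lia) hst
    have h₂ : p ^ t < p ^ n := Nat.pow_lt_pow_right (by lia) htn
    lia
  exact le_antisymm (not_lt.1 (key t s ht hs)) (not_lt.1 (key s t hs ht))

/-- Multiplication by `p` modulo `p ^ n - 1` raises the layer by one. -/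
theorem InLayer.mul_mod {p n a s : ℕ} (hp : 2 ≤ p) (h : InLayer p n a s) (hs : s + 1 < n) :
    InLayer p n (p * a % (p ^ n - 1)) (s + 1) := by
  obtain ⟨-, h₁, h₂⟩ := h
  have hs₀ : 0 < p ^ s := Nat.pow_pos (by lia)
  have hsn : p ^ s < p ^ n := Nat.pow_lt_pow_right (by lia) (by lia)
  have hsn' : p ^ (s + 2) ≤ p ^ n := Nat.pow_le_pow_right (by lia) hs
  obtain ⟨c, hc⟩ : ∃ c, p ^ n = a + c + 1 := ⟨p ^ n - 1 - a, by lia⟩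
  have hc₁ : p ^ s ≤ c := by lia
  have hc₂ : c + 1 ≤ p ^ (s + 1) := by lia
  have hpc₁ : p ^ (s + 1) ≤ p * c := by
    rw [pow_succ']; exact Nat.mul_le_mul_left p hc₁
  have hpc₂ : p * c + p ≤ p ^ (s + 2) := by
    rw [pow_succ' p (s + 1)]; exact Nat.mul_le_mul_left p hc₂
  have hs₁ : 0 < p ^ (s + 1) := Nat.pow_pos (by lia)
  obtain ⟨d, hd⟩ : ∃ d, a + c = p * c + d := ⟨a + c - p * c, by lia⟩
  obtain ⟨q, rfl⟩ : ∃ q, p = q + 1 := ⟨p - 1, by lia⟩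
  have hmod : (q + 1) * a % ((q + 1) ^ n - 1) = d := by
    have hN : (q + 1) ^ n - 1 = a + c := by lia
    have hmul : (q + 1) * a = d + (a + c) * q := by linarith
    rw [hN, hmul, Nat.add_mul_mod_self_left, Nat.mod_eq_of_lt (by lia)]
  rw [hmod]
  refine ⟨hs, ?_, ?_⟩
  · rw [show s + 1 + 1 = s + 2 from rfl]; lia
  · lia

/-- The claim following Definition 4.12 of the paper: for `0 ≤ a ≤ p^n - 2`, letting
`Z i` be the layer of `p^i * a mod (p^n - 1)` and `λ_j` the number of indices
`i < n` with `Z i = n - 1 - j`, the sequence `(λ_0, …, λ_{n-1})` is a partition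
of `n`. -/
theorem frobenius_layers_form_partition (p n a : ℕ) (hp : 2 ≤ p) (hn : 1 ≤ n)
    (ha : a ≤ p ^ n - 2) (Z : ℕ → ℕ)
    (hZ : ∀ i < n, InLayer p n ((p ^ i * a) % (p ^ n - 1)) (Z i)) :
    (∀ j, j + 1 < n →
      ((Finset.range n).filter (fun i => Z i = n - 1 - (j + 1))).card ≤
        ((Finset.range n).filter (fun i => Z i = n - 1 - j)).card) ∧
    (∑ j ∈ Finset.range n,
      ((Finset.range n).filter (fun i => Z i = n - 1 - j)).card) = n := by
  have step : ∀ i < n, Z i + 1 < n → Z ((i + 1) % n) = Z i + 1 := by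
    intro i hi hlt
    have h := (hZ i hi).mul_mod hp hlt
    rw [Nat.mul_mod_mod, ← mul_assoc, ← pow_succ'] at h
    have hcyc : p ^ (i + 1) * a % (p ^ n - 1) = p ^ ((i + 1) % n) * a % (p ^ n - 1) := by
      rcases Nat.lt_or_ge (i + 1) n with hin | hin
      · rw [Nat.mod_eq_of_lt hin]
      · obtain rfl : i + 1 = n := by lia
        have hpow : p ^ (i + 1) * a = a + (p ^ (i + 1) - 1) * a := by
          rw [Nat.sub_mul, one_mul]
          have := Nat.le_mul_of_pos_left a (Nat.pow_pos (n := i + 1) (show 0 < p by lia))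
          lia
        rw [Nat.mod_self, pow_zero, one_mul, hpow, Nat.add_mul_mod_self_left]
    rw [hcyc] at h
    exact (hZ _ (Nat.mod_lt _ hn)).unique hp h
  refine ⟨fun j hj => ?_, ?_⟩
  · refine Finset.card_le_card_of_injOn (fun i => (i + 1) % n) ?_ ?_
    · intro i hi
      simp only [Finset.coe_filter, Finset.mem_range, Set.mem_ofPred_eq] at hi ⊢
      refine ⟨Nat.mod_lt _ hn, ?_⟩
      rw [step i hi.1 (by lia)]
      lia
    · intro i hi k hk hik
      simp only [Finset.coe_filter, Finset.mem_range, Set.mem_ofPred_eq] at hi hk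
      have hmod : i ≡ k [MOD n] := Nat.ModEq.add_right_cancel' 1 hik
      exact hmod.eq_of_lt_of_lt hi.1 hk.1
  · have hmaps : ∀ i ∈ Finset.range n, n - 1 - Z i ∈ Finset.range n := by
      intro i _
      rw [Finset.mem_range]
      lia
    conv_rhs => rw [← Finset.card_range n, Finset.card_eq_sum_card_fiberwise hmaps]
    refine Finset.sum_congr rfl fun j hj => congrArg Finset.card (Finset.filter_congr ?_)
    intro i hi
    have := (hZ i (Finset.mem_range.1 hi)).1
    rw [Finset.mem_range] at hj
    lia
end

section
/- Let p be an odd prime, n ≥ 1, and let a be an integer with 0 ≤ a ≤ p^n − 2 lying in layer s, with s-th base-p digit a_s. Define the partner a′ = a + (p−2−2·a_s)·p^s. Then: (1) 0 ≤ a′ ≤ p^n − 2 and a′ is also in layer s; (2) the partner of a′ is a (the partner map is an involution); and (3) a and a′ have opposite parity, i.e. a + a′ is odd. -/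
theorem digit_mul_add {p s d r : ℕ} (k : ℕ) (hd : d < p) (hr : r < p ^ s) :
    digit p (p ^ s * (p * k + d) + r) s = d := by
  rw [digit, Nat.mul_add_div (by lia), Nat.div_eq_of_lt hr, add_zero, Nat.mul_add_mod,
    Nat.mod_eq_of_lt hd]

/-- The integers in layer `s` are those whose `s`-th digit is at most `p - 2` and whose higher
digits form the largest possible number `k = p ^ (n - s - 1) - 1`. -/
theorem inLayer_iff {p n s a k : ℕ} (hp : 2 ≤ p) (hs : s < n)
    (hk : p ^ n = p ^ s * (p * (k + 1))) :
    InLayer p n a s ↔ ∃ d r, d + 2 ≤ p ∧ r < p ^ s ∧ a = p ^ s * (p * k + d) + r := by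
  have hP : 0 < p ^ s := pow_pos (by lia) s
  simp only [InLayer, hs, true_and, hk, pow_succ]
  generalize p ^ s = P at hP
  have htop : P * (p * (k + 1)) = P * (p * k) + P * p := by ring
  constructor
  · rintro ⟨h₁, h₂⟩
    obtain ⟨b, rfl⟩ : ∃ b, a = P * (p * k) + b := Nat.exists_eq_add_of_le (by lia)
    have hPp := Nat.mul_le_mul_left P hp
    have hlt := Nat.mod_lt b hP
    have hdiv := Nat.div_add_mod b P
    refine ⟨b / P, b % P, ?_, hlt, by rw [mul_add]; lia⟩
    by_contra! hlarge
    have := Nat.mul_le_mul_left P (show p ≤ b / P + 1 by lia)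
    rw [mul_add, mul_one] at this
    lia
  · rintro ⟨d, r, hd, hr, rfl⟩
    have := Nat.mul_le_mul_left P hd
    rw [mul_add, mul_comm P 2] at this
    rw [htop, mul_add]
    lia

/-- Remarks after Definitions 3.8 and 3.10 of the paper: for odd `p`, the partner
`a' = a + (p - 2 - 2 a_s) p^s` of an integer `a` in layer `s` again lies in
`[0, p^n - 2]` and in layer `s`, the partner map is an involution, and `a` and `a'`
have opposite parity. -/
theorem partner_involution (p n s : ℕ) (a : ℕ) (a' : ℤ) (hp : p.Prime) (hodd : Odd p)
    (hn : 1 ≤ n) (ha : a ≤ p ^ n - 2) (hlayer : InLayer p n a s)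
    (ha' : a' = (a : ℤ) + ((p : ℤ) - 2 - 2 * (digit p a s : ℤ)) * (p : ℤ) ^ s) :
    (0 ≤ a' ∧ a' ≤ (p : ℤ) ^ n - 2 ∧ InLayer p n a'.toNat s) ∧
    ((a : ℤ) = a' + ((p : ℤ) - 2 - 2 * (digit p a'.toNat s : ℤ)) * (p : ℤ) ^ s) ∧
    Odd ((a : ℤ) + a') := by
  have hp2 : 2 ≤ p := hp.two_le
  have hs : s < n := hlayer.1
  have hP : 0 < p ^ s := pow_pos hp.pos s
  obtain ⟨k, hk⟩ : ∃ k, p ^ n = p ^ s * (p * (k + 1)) := by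
    refine ⟨p ^ (n - (s + 1)) - 1, ?_⟩
    rw [Nat.sub_add_cancel (Nat.one_le_pow _ _ hp.pos), ← pow_succ', ← pow_add]
    congr 1
    lia
  obtain ⟨d, r, hd, hr, rfl⟩ := (inLayer_iff hp2 hs hk).1 hlayer
  rw [digit_mul_add k (by lia) hr] at ha'
  obtain ⟨e, he⟩ := Nat.exists_eq_add_of_le hd
  have hpe : (p : ℤ) = d + 2 + e := by exact_mod_cast he
  obtain rfl : a' = ((p ^ s * (p * k + e) + r : ℕ) : ℤ) := by
    rw [ha']
    push_cast
    linear_combination (p : ℤ) ^ s * hpe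
  have hmem : InLayer p n (p ^ s * (p * k + e) + r) s :=
    (inLayer_iff hp2 hs hk).2 ⟨e, r, by lia, hr, rfl⟩
  rw [Int.toNat_natCast, digit_mul_add k (by lia) hr]
  refine ⟨⟨Int.natCast_nonneg _, ?_, hmem⟩, ?_, ?_⟩
  · have hlarge : 2 ≤ p ^ n := hp2.trans (Nat.le_self_pow (by lia) p)
    have := hmem.2.2
    zify at hlarge
    rw [← Nat.cast_pow]
    lia
  · push_cast
    linear_combination -(p : ℤ) ^ s * hpe
  · have hodd' : Odd ((p : ℤ) * p ^ s) := by exact_mod_cast hodd.mul hodd.pow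
    rw [ha']
    obtain ⟨c, hc⟩ := hodd'
    refine ⟨c + (p ^ s * (p * k + d) + r : ℕ) - (1 + d) * p ^ s, ?_⟩
    linear_combination hc
end

section
/- Let p be a prime, n ≥ 1, q = p^n, and let G = SL(2, F_q) be the special linear group of degree two over the field F_q with q elements. Let P ≤ G be the subgroup of upper unitriangular matrices {[[1, b], [0, 1]] : b ∈ F_q}. Then P is a Sylow p-subgroup of G, and for every g ∈ G the intersection P ∩ gPg⁻¹ is either all of P or the trivial subgroup; that is, G has the trivial intersection property with respect to P. -/
open Matrix

/-- The subgroup of upper unitriangular matrices `[[1, b], [0, 1]]` in `SL(2, F)`. -/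
def upperUnitriangular (F : Type*) [Field F] :
    Subgroup (Matrix.SpecialLinearGroup (Fin 2) F) where
  carrier := {g | ∃ b : F, (g : Matrix (Fin 2) (Fin 2) F) = !![1, b; 0, 1]}
  one_mem' := ⟨0, by simp [Matrix.SpecialLinearGroup.coe_one, Matrix.one_fin_two]⟩
  mul_mem' := by
    rintro g h ⟨a, ha⟩ ⟨b, hb⟩
    refine ⟨a + b, ?_⟩
    rw [Matrix.SpecialLinearGroup.coe_mul, ha, hb, Matrix.mul_fin_two]
    ring_nf
  inv_mem' := by
    rintro g ⟨b, hb⟩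
    have hdet : Matrix.det !![(1 : F), -b; 0, 1] = 1 := by
      simp [Matrix.det_fin_two_of]
    let h : Matrix.SpecialLinearGroup (Fin 2) F := ⟨!![1, -b; 0, 1], hdet⟩
    have hmul : g * h = 1 := by
      apply Subtype.ext
      show (g : Matrix (Fin 2) (Fin 2) F) * (h : Matrix (Fin 2) (Fin 2) F) = _
      rw [Matrix.SpecialLinearGroup.coe_one, hb]
      show !![1, b; 0, 1] * !![1, -b; 0, 1] = _
      rw [Matrix.mul_fin_two, Matrix.one_fin_two]
      norm_num
    exact ⟨-b, by rw [inv_eq_of_mul_eq_one_right hmul]⟩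

section UpperUnitriangular

variable {F : Type*} [Field F]

theorem mem_upperUnitriangular_iff {g : Matrix.SpecialLinearGroup (Fin 2) F} :
    g ∈ upperUnitriangular F ↔ g.1 0 0 = 1 ∧ g.1 1 0 = 0 ∧ g.1 1 1 = 1 := by
  constructor
  · rintro ⟨b, hb⟩
    simp [hb]
  · rintro ⟨h00, h10, h11⟩
    refine ⟨g.1 0 1, ?_⟩
    ext i j
    fin_cases i <;> fin_cases j <;> simp [h00, h10, h11]

theorem isPGroup_upperUnitriangular (p : ℕ) [Fact p.Prime] [CharP F p] :
    IsPGroup p (upperUnitriangular F) := by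
  rintro ⟨g, b, hb⟩
  refine ⟨1, Subtype.ext (Matrix.SpecialLinearGroup.ext _ _ fun i j => ?_)⟩
  have hsq : (g.1 - 1) ^ 2 = 0 := by
    rw [hb, sq]
    ext i j
    fin_cases i <;> fin_cases j <;> simp [Matrix.mul_apply]
  have hp : (g.1 - 1) ^ p = 0 :=
    pow_eq_zero_of_le (Fact.out : p.Prime).two_le hsq
  rw [sub_pow_char_of_commute p (Commute.one_right _), one_pow, sub_eq_zero] at hp
  simp [hp]

/-- In characteristic `p`, an element of `SL(2, F)` of `p`-power order has trace `2`. -/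
theorem trace_eq_two_of_pow_char_pow_eq_one (p : ℕ) [Fact p.Prime] [CharP F p]
    {g : Matrix.SpecialLinearGroup (Fin 2) F} {k : ℕ} (hg : g ^ p ^ k = 1) :
    g.1 0 0 + g.1 1 1 = 2 := by
  have hg' : g.1 ^ p ^ k = 1 := by
    simpa using congrArg Subtype.val hg
  have hnil : IsNilpotent (g.1 - 1) := by
    refine ⟨p ^ k, ?_⟩
    rw [sub_pow_char_pow_of_commute p k (Commute.one_right _), hg', one_pow, sub_self]
  have htr := (Matrix.isNilpotent_trace_of_isNilpotent hnil).eq_zero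
  simp only [Matrix.trace_fin_two, Matrix.sub_apply, Matrix.one_apply_eq] at htr
  linear_combination htr

theorem le_upperUnitriangular_of_isPGroup (p : ℕ) [Fact p.Prime] [CharP F p]
    {Q : Subgroup (Matrix.SpecialLinearGroup (Fin 2) F)} (hQ : IsPGroup p Q)
    (hle : upperUnitriangular F ≤ Q) : Q ≤ upperUnitriangular F := by
  have htrace : ∀ g ∈ Q, g.1 0 0 + g.1 1 1 = 2 := fun g hg => by
    obtain ⟨k, hk⟩ := hQ ⟨g, hg⟩
    exact trace_eq_two_of_pow_char_pow_eq_one p (congrArg Subtype.val hk)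
  intro g hg
  let u : Matrix.SpecialLinearGroup (Fin 2) F := ⟨!![1, 1; 0, 1], by simp⟩
  have htr := htrace g hg
  have hutr := htrace (u * g) (Q.mul_mem (hle ⟨1, rfl⟩) hg)
  have hdet := g.2
  rw [Matrix.det_fin_two] at hdet
  rw [Matrix.SpecialLinearGroup.coe_mul] at hutr
  simp only [u, Matrix.mul_apply, Fin.sum_univ_two, Matrix.of_apply, Matrix.cons_val',
    Matrix.cons_val_zero, Matrix.cons_val_one, Matrix.cons_val_fin_one, one_mul, zero_mul, zero_add] at hutr
  have h10 : g.1 1 0 = 0 := by linear_combination hutr - htr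
  have h00 : g.1 0 0 = 1 := by
    have : (g.1 0 0 - 1) ^ 2 = 0 := by
      linear_combination g.1 0 0 * htr - hdet - g.1 0 1 * h10
    exact sub_eq_zero.mp (pow_eq_zero_iff two_ne_zero |>.mp this)
  exact mem_upperUnitriangular_iff.mpr ⟨h00, h10, by linear_combination htr - h00⟩

theorem conj_mem_upperUnitriangular {g x : Matrix.SpecialLinearGroup (Fin 2) F}
    (hg : g.1 1 0 = 0) (hx : x ∈ upperUnitriangular F) :
    g⁻¹ * x * g ∈ upperUnitriangular F := by
  obtain ⟨b, hb⟩ := hx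
  have hdet := g.2
  rw [Matrix.det_fin_two, hg, mul_zero, sub_zero] at hdet
  rw [mem_upperUnitriangular_iff]
  simp [Matrix.mul_apply, hb, Matrix.adjugate_fin_two, hg, hdet, mul_comm (g.1 1 1)]

theorem apply_one_zero_eq_zero_of_conj_mem {g y : Matrix.SpecialLinearGroup (Fin 2) F}
    (hy : y ∈ upperUnitriangular F) (hgy : g * y * g⁻¹ ∈ upperUnitriangular F)
    (hne : g * y * g⁻¹ ≠ 1) : g.1 1 0 = 0 := by
  obtain ⟨c, hc⟩ := hy
  obtain ⟨b, hb⟩ := hgy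
  have hb0 : b ≠ 0 := by
    rintro rfl
    exact hne (Subtype.ext (hb.trans Matrix.one_fin_two.symm))
  have hcomm : (g * y * g⁻¹).1 * g.1 = g.1 * y.1 :=
    congrArg Subtype.val (inv_mul_cancel_right (g * y) g)
  rw [hb, hc] at hcomm
  have h00 := congrFun (congrFun hcomm 0) 0
  simpa [Matrix.mul_apply, hb0] using h00

theorem upperUnitriangular_inf_conj (g : Matrix.SpecialLinearGroup (Fin 2) F) :
    upperUnitriangular F ⊓ (upperUnitriangular F).map (MulAut.conj g).toMonoidHom =
        upperUnitriangular F ∨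
      upperUnitriangular F ⊓ (upperUnitriangular F).map (MulAut.conj g).toMonoidHom = ⊥ := by
  by_cases hg : g.1 1 0 = 0
  · refine Or.inl (inf_eq_left.mpr fun x hx => ?_)
    exact ⟨g⁻¹ * x * g, conj_mem_upperUnitriangular hg hx, by simp [mul_assoc]⟩
  · refine Or.inr ((Subgroup.eq_bot_iff_forall _).mpr ?_)
    rintro _ ⟨hx, y, hy, rfl⟩
    by_contra hne
    exact hg (apply_one_zero_eq_zero_of_conj_mem hy hx hne)

end UpperUnitriangular

/-- The upper unitriangular subgroup `P` of `SL(2, F_q)`, `q = p^n`, is a Sylow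
`p`-subgroup, and `G = SL(2, F_q)` has the trivial intersection property with respect
to `P`: every conjugate `gPg⁻¹` intersects `P` in either `P` or the trivial subgroup. -/
theorem sl2_sylow_trivial_intersection (p n : ℕ) [Fact p.Prime] (hn : n ≠ 0) :
    (∃ S : Sylow p (Matrix.SpecialLinearGroup (Fin 2) (GaloisField p n)),
      (S : Subgroup (Matrix.SpecialLinearGroup (Fin 2) (GaloisField p n))) =
        upperUnitriangular (GaloisField p n)) ∧
    ∀ g : Matrix.SpecialLinearGroup (Fin 2) (GaloisField p n),
      upperUnitriangular (GaloisField p n) ⊓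
          Subgroup.map (MulAut.conj g).toMonoidHom (upperUnitriangular (GaloisField p n)) =
        upperUnitriangular (GaloisField p n) ∨
      upperUnitriangular (GaloisField p n) ⊓
          Subgroup.map (MulAut.conj g).toMonoidHom (upperUnitriangular (GaloisField p n)) =
        ⊥ := by
  refine ⟨⟨⟨upperUnitriangular _, isPGroup_upperUnitriangular p, fun hQ hle =>
    le_antisymm (le_upperUnitriangular_of_isPGroup p hQ hle) hle⟩, rfl⟩,
    upperUnitriangular_inf_conj⟩
end
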